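/- Let r ≥ 1 and N ≥ 2r + 1. Let φ_m be a left-toggle radius-r local rule and let φ_b be a radius-r local rule for which there exists g : Bool → Bool with g = id or g = not such that φ_b(v) = g(v(0)) for every neighborhood v. Then the hybrid global map Φ determined by φ_m and φ_b is injective on configurations ZMod N → Bool: any two configurations with the same image under Φ are equal (every configuration has at most one pre-image). -/

import Mathlib

/-- The radius-`r` neighborhood of cell `i` in configuration `s` on a cyclic
lattice of `N` cells: position `j` holds the value of cell `i + j - r`. -/
def nbhd (N r : ℕ) (s : ZMod N → Bool) (i : ZMod N) : Fin (2*r+1) → Bool :=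
  fun j => s (i + ((j : ℕ) : ZMod N) - ((r : ℕ) : ZMod N))

/-- A radius-`r` local rule is left-toggle if two neighborhoods agreeing
everywhere except at position 0 (the leftmost cell) get different outputs. -/
def LeftToggle (r : ℕ) (f : (Fin (2*r+1) → Bool) → Bool) : Prop :=
  ∀ v w : Fin (2*r+1) → Bool,
    (∀ j, j ≠ 0 → v j = w j) → v 0 ≠ w 0 → f v ≠ f w

/-- A radius-`r` local rule is right-toggle if two neighborhoods agreeing
everywhere except at position `2r` (the rightmost cell) get different outputs. -/
def RightToggle (r : ℕ) (f : (Fin (2*r+1) → Bool) → Bool) : Prop :=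
  ∀ v w : Fin (2*r+1) → Bool,
    (∀ j, j ≠ Fin.last (2*r) → v j = w j) →
      v (Fin.last (2*r)) ≠ w (Fin.last (2*r)) → f v ≠ f w

/-- The hybrid global map: cells `0, …, 2r-1` (the border) are updated with
the border rule `φb`, all other cells with the main rule `φm`. -/
def hybrid (N r : ℕ) (φm φb : (Fin (2*r+1) → Bool) → Bool)
    (s : ZMod N → Bool) : ZMod N → Bool :=
  fun i => if i.val < 2*r then φb (nbhd N r s i) else φm (nbhd N r s i)

/-- A left-toggle rule determines the leftmost cell from its output and the other cells. -/
theorem LeftToggle.apply_zero_eq {r : ℕ} {f : (Fin (2*r+1) → Bool) → Bool}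
    (hf : LeftToggle r f) {v w : Fin (2*r+1) → Bool}
    (h : ∀ j, j ≠ 0 → v j = w j) (hvw : f v = f w) : v 0 = w 0 := by
  by_contra hne
  exact hf v w h hne hvw

theorem nbhd_zero (N r : ℕ) (s : ZMod N → Bool) (i : ZMod N) :
    nbhd N r s i 0 = s (i - r) := by
  simp [nbhd]

/-- for `r ≥ 1` and `N ≥ 2r+1`, with a left-toggle main rule
and a border rule that always copies or always complements the leftmost input
bit, the hybrid global map is injective (at most one pre-image). -/
theorem hca_injective
    (r N : ℕ) (hr : 1 ≤ r) (hN : 2*r+1 ≤ N)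
    (φm φb : (Fin (2*r+1) → Bool) → Bool)
    (hm : LeftToggle r φm)
    (g : Bool → Bool) (hg : g = id ∨ g = not)
    (hb : ∀ v : Fin (2*r+1) → Bool, φb v = g (v 0)) :
    Function.Injective (hybrid N r φm φb) := by
  have : NeZero N := ⟨by omega⟩
  have hg_inj : Function.Injective g := by
    rcases hg with rfl | rfl
    · exact Function.injective_id
    · exact Bool.not_injective
  intro s t hst
  have border (i : ZMod N) (hi : i.val < 2*r) : s (i - r) = t (i - r) := by
    have h := congrFun hst i
    simp only [hybrid, if_pos hi, hb, nbhd_zero] at h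
    exact hg_inj h
  -- Outside the border the cells are determined from right to left.
  have all (d : ℕ) : ∀ i : ZMod N, N - i.val = d → s (i - r) = t (i - r) := by
    induction d using Nat.strong_induction_on with
    | _ d ih =>
      intro i hd
      by_cases hi : i.val < 2*r
      · exact border i hi
      have h := congrFun hst i
      simp only [hybrid, if_neg hi] at h
      rw [← nbhd_zero N r s, ← nbhd_zero N r t]
      refine hm.apply_zero_eq (fun j hj => ?_) h
      have hj_pos : 0 < (j : ℕ) := Nat.pos_of_ne_zero (Fin.val_ne_zero_iff.mpr hj)
      have hj_lt := j.isLt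
      have hi_lt := i.val_lt
      have hval : (i + ((j : ℕ) : ZMod N)).val = (i.val + j) % N := by
        rw [ZMod.val_add, ZMod.val_cast_of_lt (by omega)]
      by_cases hlt : i.val + j < N
      · rw [Nat.mod_eq_of_lt hlt] at hval
        exact ih _ (by omega) (i + ((j : ℕ) : ZMod N)) rfl
      · rw [Nat.mod_eq_sub_mod (by omega), Nat.mod_eq_of_lt (by omega)] at hval
        exact border _ (by omega)
  funext i
  simpa using all _ (i + r) rfl
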